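/- The quantum relative entropy S(ρ‖σ) = Trace(ρ log ρ − ρ log σ) is jointly convex on pairs of positive definite n×n complex density matrices: if ρ₁, ρ₂, σ₁, σ₂ are positive definite matrices with trace 1, and 0 ≤ c ≤ 1, then S(cρ₁ + (1-c)ρ₂ ‖ cσ₁ + (1-c)σ₂) ≤ c·S(ρ₁‖σ₁) + (1-c)·S(ρ₂‖σ₂). -/

import Mathlib

open Matrix
open scoped ComplexOrder

/-- The quantum relative entropy `S(ρ‖σ) = Trace (ρ log ρ − ρ log σ)`, where the matrix
logarithm is given by the continuous functional calculus. -/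
noncomputable def quantumRelEntropy {k : ℕ} (ρ σ : Matrix (Fin k) (Fin k) ℂ) : ℝ :=
  ((ρ * cfc Real.log ρ - ρ * cfc Real.log σ).trace).re

section SpectralSums

variable {n : Type*} [Fintype n] [DecidableEq n]

/-- The matrix of inner products `⟨f j, e i⟩` of the eigenvectors `f j` of `σ` and `e i` of `ρ`. -/
noncomputable def eigenOverlap {ρ σ : Matrix n n ℂ} (hρ : ρ.IsHermitian) (hσ : σ.IsHermitian) :
    Matrix n n ℂ :=
  star (hσ.eigenvectorUnitary : Matrix n n ℂ) * (hρ.eigenvectorUnitary : Matrix n n ℂ)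

/-- The trace of a product of functions of two Hermitian matrices, as a double sum over
eigenvalues. -/
lemma re_trace_cfc_mul_cfc {ρ σ : Matrix n n ℂ} (hρ : ρ.IsHermitian) (hσ : σ.IsHermitian)
    (f g : ℝ → ℝ) :
    (cfc f ρ * cfc g σ).trace.re =
      ∑ i, ∑ j, f (hρ.eigenvalues i) * g (hσ.eigenvalues j) *
        Complex.normSq (eigenOverlap hρ hσ j i) := by
  rw [hρ.cfc_eq, hσ.cfc_eq, IsHermitian.cfc, IsHermitian.cfc, Unitary.conjStarAlgAut_apply,
    Unitary.conjStarAlgAut_apply]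
  have hcyc : ∀ (U V D E : Matrix n n ℂ), (U * D * star U * (V * E * star V)).trace =
      (D * star (star V * U) * E * (star V * U)).trace := by
    intro U V D E
    rw [mul_assoc, mul_assoc, trace_mul_comm]
    simp [mul_assoc]
  rw [hcyc, ← eigenOverlap, trace, Complex.re_sum]
  refine Finset.sum_congr rfl fun i _ => ?_
  rw [diag_apply, mul_apply, Complex.re_sum]
  refine Finset.sum_congr rfl fun j _ => ?_
  simp only [star_eq_conjTranspose, mul_diagonal, diagonal_mul, conjTranspose_apply,
    Function.comp_apply, Complex.coe_algebraMap, RCLike.star_def, Complex.normSq_apply]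
  simp
  ring

/-- A concave quadratic function of `X`, jointly affine in `(ρ, σ)`, whose maximum over `X` is a
resolvent-type quadratic form in `σ - ρ`. -/
noncomputable def divergenceForm (t : ℝ) (ρ σ X : Matrix n n ℂ) : ℝ :=
  2 * ((σ - ρ)ᴴ * X).trace.re - (1 - t) * (Xᴴ * σ * X).trace.re - t * (Xᴴ * X * ρ).trace.re

lemma divergenceForm_convexComb (c t : ℝ) (ρ₁ ρ₂ σ₁ σ₂ X : Matrix n n ℂ) :
    divergenceForm t (c • ρ₁ + (1 - c) • ρ₂) (c • σ₁ + (1 - c) • σ₂) X =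
      c * divergenceForm t ρ₁ σ₁ X + (1 - c) * divergenceForm t ρ₂ σ₂ X := by
  simp only [divergenceForm, conjTranspose_sub, conjTranspose_add, conjTranspose_smul, sub_mul,
    add_mul, mul_add, smul_mul_assoc, mul_smul_comm, trace_add, trace_sub, trace_smul,
    Complex.add_re, Complex.sub_re, Complex.smul_re, star_trivial, smul_eq_mul]
  ring

/-- The divergence form after a change of orthonormal bases. -/
lemma divergenceForm_conj {ρ σ U V L M : Matrix n n ℂ} (hρ : ρ.IsHermitian) (hσ : σ.IsHermitian)
    (hU : star U * U = 1) (hV : star V * V = 1) (hρs : ρ = U * L * star U)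
    (hσs : σ = V * M * star V) (t : ℝ) (Y : Matrix n n ℂ) :
    divergenceForm t ρ σ (V * Y * star U) =
      2 * ((star (star V * U) * M - L * star (star V * U)) * Y).trace.re -
        (1 - t) * (star Y * M * Y).trace.re - t * (L * star Y * Y).trace.re := by
  have hU' (A : Matrix n n ℂ) : star U * (U * A) = A := by rw [← mul_assoc, hU, one_mul]
  have hV' (A : Matrix n n ℂ) : star V * (V * A) = A := by rw [← mul_assoc, hV, one_mul]
  have hlin : ((σ - ρ)ᴴ * (V * Y * star U)).trace =
      ((star (star V * U) * M - L * star (star V * U)) * Y).trace := by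
    rw [conjTranspose_sub, hρ.eq, hσ.eq, ← mul_assoc, trace_mul_comm, hσs, hρs]
    simp only [mul_assoc, mul_sub, sub_mul, star_mul, star_star, hV', hU']
  have hleft : ((V * Y * star U)ᴴ * σ * (V * Y * star U)).trace = (star Y * M * Y).trace := by
    rw [hσs, ← star_eq_conjTranspose, ← mul_assoc, trace_mul_comm]
    simp only [mul_assoc, star_mul, star_star, hV', hU']
  have hright : ((V * Y * star U)ᴴ * (V * Y * star U) * ρ).trace = (L * star Y * Y).trace := by
    rw [hρs, ← star_eq_conjTranspose, ← mul_assoc, trace_mul_comm]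
    simp only [mul_assoc, star_mul, star_star, hV', hU']
    rw [← mul_assoc, trace_mul_comm L, mul_assoc]
  rw [divergenceForm, hlin, hleft, hright]

/-- In the eigenbases of `ρ` and `σ` the divergence form is diagonal. -/
lemma divergenceForm_eigenvectorUnitary {ρ σ : Matrix n n ℂ} (hρ : ρ.IsHermitian)
    (hσ : σ.IsHermitian) (t : ℝ) (Y : Matrix n n ℂ) :
    divergenceForm t ρ σ ((hσ.eigenvectorUnitary : Matrix n n ℂ) * Y *
        star (hρ.eigenvectorUnitary : Matrix n n ℂ)) =
      ∑ i, ∑ j, (2 * (hσ.eigenvalues j - hρ.eigenvalues i) *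
          (star (eigenOverlap hρ hσ j i) * Y j i).re -
        ((1 - t) * hσ.eigenvalues j + t * hρ.eigenvalues i) * Complex.normSq (Y j i)) := by
  rw [divergenceForm_conj hρ hσ (Unitary.star_mul_self_of_mem hρ.eigenvectorUnitary.2)
    (Unitary.star_mul_self_of_mem hσ.eigenvectorUnitary.2) hρ.spectral_theorem
    hσ.spectral_theorem, ← eigenOverlap]
  simp only [trace, Complex.re_sum, Finset.mul_sum, ← Finset.sum_sub_distrib]
  refine Finset.sum_congr rfl fun i _ => ?_
  simp only [diag_apply, mul_apply (N := Y), Complex.re_sum, Finset.mul_sum,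
    ← Finset.sum_sub_distrib]
  refine Finset.sum_congr rfl fun j _ => ?_
  simp only [star_eq_conjTranspose, Matrix.sub_apply, mul_diagonal, diagonal_mul,
    conjTranspose_apply, Function.comp_apply, RCLike.star_def, Complex.normSq_apply]
  simp
  ring

/-- The maximum of `divergenceForm t ρ σ`, as a double sum over eigenvalues. -/
noncomputable def divergenceMax {ρ σ : Matrix n n ℂ} (hρ : ρ.IsHermitian) (hσ : σ.IsHermitian)
    (t : ℝ) : ℝ :=
  ∑ i, ∑ j, (hσ.eigenvalues j - hρ.eigenvalues i) ^ 2 /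
    ((1 - t) * hσ.eigenvalues j + t * hρ.eigenvalues i) *
      Complex.normSq (eigenOverlap hρ hσ j i)

lemma segment_pos {a b t : ℝ} (ha : 0 < a) (hb : 0 < b) (ht : t ∈ Set.Icc (0 : ℝ) 1) :
    0 < (1 - t) * a + t * b := by
  obtain ⟨h0, h1⟩ := ht
  rcases h0.eq_or_lt with rfl | h0
  · simpa using ha
  · have := mul_pos h0 hb
    have := mul_nonneg (sub_nonneg.2 h1) ha.le
    linarith

lemma divergenceForm_le_divergenceMax {ρ σ : Matrix n n ℂ} (hρ : ρ.PosDef) (hσ : σ.PosDef)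
    {t : ℝ} (ht : t ∈ Set.Icc (0 : ℝ) 1) (X : Matrix n n ℂ) :
    divergenceForm t ρ σ X ≤ divergenceMax hρ.1 hσ.1 t := by
  obtain ⟨Y, rfl⟩ : ∃ Y, X = (hσ.1.eigenvectorUnitary : Matrix n n ℂ) * Y *
      star (hρ.1.eigenvectorUnitary : Matrix n n ℂ) := by
    refine ⟨star (hσ.1.eigenvectorUnitary : Matrix n n ℂ) * X *
      (hρ.1.eigenvectorUnitary : Matrix n n ℂ), ?_⟩
    have hU := Unitary.mul_star_self_of_mem hρ.1.eigenvectorUnitary.2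
    have hV := Unitary.mul_star_self_of_mem hσ.1.eigenvectorUnitary.2
    rw [← mul_assoc, ← mul_assoc, hV, one_mul, mul_assoc, hU, mul_one]
  rw [divergenceForm_eigenvectorUnitary, divergenceMax]
  refine Finset.sum_le_sum fun i _ => Finset.sum_le_sum fun j _ => ?_
  have hu := segment_pos (hσ.eigenvalues_pos j) (hρ.eigenvalues_pos i) ht
  set u := (1 - t) * hσ.1.eigenvalues j + t * hρ.1.eigenvalues i
  set d := hσ.1.eigenvalues j - hρ.1.eigenvalues i
  rw [div_mul_eq_mul_div, le_div_iff₀ hu]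
  simp only [Complex.normSq_apply, Complex.mul_re, RCLike.star_def, Complex.conj_re,
    Complex.conj_im]
  nlinarith [sq_nonneg (d * (eigenOverlap hρ.1 hσ.1 j i).re - u * (Y j i).re),
    sq_nonneg (d * (eigenOverlap hρ.1 hσ.1 j i).im - u * (Y j i).im)]

lemma exists_divergenceForm_eq_divergenceMax {ρ σ : Matrix n n ℂ} (hρ : ρ.PosDef)
    (hσ : σ.PosDef) {t : ℝ} (ht : t ∈ Set.Icc (0 : ℝ) 1) :
    ∃ X, divergenceForm t ρ σ X = divergenceMax hρ.1 hσ.1 t := by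
  refine ⟨(hσ.1.eigenvectorUnitary : Matrix n n ℂ) *
    of (fun j i => (((hσ.1.eigenvalues j - hρ.1.eigenvalues i) /
      ((1 - t) * hσ.1.eigenvalues j + t * hρ.1.eigenvalues i) : ℝ) : ℂ) *
        eigenOverlap hρ.1 hσ.1 j i) *
    star (hρ.1.eigenvectorUnitary : Matrix n n ℂ), ?_⟩
  rw [divergenceForm_eigenvectorUnitary, divergenceMax]
  refine Finset.sum_congr rfl fun i _ => Finset.sum_congr rfl fun j _ => ?_
  have hu := (segment_pos (hσ.eigenvalues_pos j) (hρ.eigenvalues_pos i) ht).ne'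
  rw [of_apply, map_mul, Complex.normSq_ofReal]
  set u := (1 - t) * hσ.1.eigenvalues j + t * hρ.1.eigenvalues i
  set d := hσ.1.eigenvalues j - hρ.1.eigenvalues i
  have hw (w : ℂ) : (star w * w).re = Complex.normSq w := by
    rw [RCLike.star_def, ← Complex.normSq_eq_conj_mul_self, Complex.ofReal_re]
  rw [mul_left_comm, Complex.re_ofReal_mul, hw]
  field_simp
  ring

/-- Joint convexity of the maximum of the divergence form. -/
lemma divergenceMax_convexComb_le {ρ₁ ρ₂ σ₁ σ₂ : Matrix n n ℂ} (hρ₁ : ρ₁.PosDef)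
    (hρ₂ : ρ₂.PosDef) (hσ₁ : σ₁.PosDef) (hσ₂ : σ₂.PosDef) {c t : ℝ} (hc0 : 0 ≤ c) (hc1 : c ≤ 1)
    (hρ : (c • ρ₁ + (1 - c) • ρ₂).PosDef) (hσ : (c • σ₁ + (1 - c) • σ₂).PosDef)
    (ht : t ∈ Set.Icc (0 : ℝ) 1) :
    divergenceMax hρ.1 hσ.1 t ≤
      c * divergenceMax hρ₁.1 hσ₁.1 t + (1 - c) * divergenceMax hρ₂.1 hσ₂.1 t := by
  obtain ⟨X, hX⟩ := exists_divergenceForm_eq_divergenceMax hρ hσ ht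
  rw [← hX, divergenceForm_convexComb]
  exact add_le_add
    (mul_le_mul_of_nonneg_left (divergenceForm_le_divergenceMax hρ₁ hσ₁ ht X) hc0)
    (mul_le_mul_of_nonneg_left (divergenceForm_le_divergenceMax hρ₂ hσ₂ ht X)
      (sub_nonneg.2 hc1))

lemma continuousOn_divergenceMax {ρ σ : Matrix n n ℂ} (hρ : ρ.PosDef) (hσ : σ.PosDef) :
    ContinuousOn (divergenceMax hρ.1 hσ.1) (Set.Icc 0 1) := by
  unfold divergenceMax
  refine continuousOn_finsetSum _ fun i _ => continuousOn_finsetSum _ fun j _ => ?_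
  refine ContinuousOn.mul (ContinuousOn.div (by fun_prop) (by fun_prop) fun t ht => ?_)
    (by fun_prop)
  exact (segment_pos (hσ.eigenvalues_pos j) (hρ.eigenvalues_pos i) ht).ne'

lemma intervalIntegrable_divergenceMax {ρ σ : Matrix n n ℂ} (hρ : ρ.PosDef) (hσ : σ.PosDef) :
    IntervalIntegrable (fun t => (1 - t) * divergenceMax hρ.1 hσ.1 t) MeasureTheory.volume 0 1 := by
  refine ContinuousOn.intervalIntegrable ?_
  rw [Set.uIcc_of_le zero_le_one]
  exact ContinuousOn.mul (by fun_prop) (continuousOn_divergenceMax hρ hσ)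

end SpectralSums

lemma intervalIntegrable_scalarDivergence {l m : ℝ} (hl : 0 < l) (hm : 0 < m) :
    IntervalIntegrable (fun t => (1 - t) * ((m - l) ^ 2 / ((1 - t) * m + t * l)))
      MeasureTheory.volume 0 1 := by
  refine ContinuousOn.intervalIntegrable ?_
  rw [Set.uIcc_of_le zero_le_one]
  refine ContinuousOn.mul (by fun_prop) (ContinuousOn.div (by fun_prop) (by fun_prop) ?_)
  exact fun t ht => ne_of_gt (segment_pos hm hl ht)

/-- Integral representation of the scalar relative entropy. -/
lemma integral_scalarDivergence {l m : ℝ} (hl : 0 < l) (hm : 0 < m) :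
    ∫ t in (0 : ℝ)..1, (1 - t) * ((m - l) ^ 2 / ((1 - t) * m + t * l)) =
      l * Real.log l - l * Real.log m - (l - m) := by
  rw [intervalIntegral.integral_eq_sub_of_hasDerivAt
    (f := fun t => (m - l) * t + l * Real.log ((1 - t) * m + t * l)) ?_
    (intervalIntegrable_scalarDivergence hl hm)]
  · simp
    ring
  · intro t ht
    rw [Set.uIcc_of_le zero_le_one] at ht
    have hu := (segment_pos hm hl ht).ne'
    have hd : HasDerivAt (fun t : ℝ => (1 - t) * m + t * l) (-1 * m + 1 * l) t :=
      (((hasDerivAt_id t).const_sub 1).mul_const m).add ((hasDerivAt_id t).mul_const l)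
    refine (((hasDerivAt_id t).const_mul (m - l)).add
      ((hd.log hu).const_mul l)).congr_deriv ?_
    rw [mul_div_assoc', mul_div_assoc', ← sub_eq_zero, add_sub_assoc, ← sub_div,
      add_div' _ _ _ hu, div_eq_zero_iff]
    left
    ring

/-- Integral representation of the quantum relative entropy. -/
lemma quantumRelEntropy_eq_integral {k : ℕ} {ρ σ : Matrix (Fin k) (Fin k) ℂ} (hρ : ρ.PosDef)
    (hσ : σ.PosDef) :
    quantumRelEntropy ρ σ =
      (ρ.trace.re - σ.trace.re) + ∫ t in (0 : ℝ)..1, (1 - t) * divergenceMax hρ.1 hσ.1 t := by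
  have hρs : IsSelfAdjoint ρ := hρ.1
  have hσs : IsSelfAdjoint σ := hσ.1
  have hlog : ρ * cfc Real.log ρ = cfc (fun x => x * Real.log x) ρ := by
    have hfin := Matrix.finite_real_spectrum (A := ρ)
    rw [cfc_mul (fun x => x) Real.log ρ (hfin.continuousOn _) (hfin.continuousOn _), cfc_id' ℝ ρ]
  have h₁ := re_trace_cfc_mul_cfc hρ.1 hσ.1 (fun x => x * Real.log x) (fun _ => 1)
  have h₂ := re_trace_cfc_mul_cfc hρ.1 hσ.1 (fun x => x) Real.log
  have h₃ := re_trace_cfc_mul_cfc hρ.1 hσ.1 (fun x => x) (fun _ => 1)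
  have h₄ := re_trace_cfc_mul_cfc hρ.1 hσ.1 (fun _ => 1) (fun x => x)
  rw [cfc_const_one ℝ σ, mul_one] at h₁ h₃
  rw [cfc_id' ℝ ρ] at h₂ h₃
  rw [cfc_const_one ℝ ρ, cfc_id' ℝ σ, one_mul] at h₄
  have hint : ∫ t in (0 : ℝ)..1, (1 - t) * divergenceMax hρ.1 hσ.1 t =
      ∑ i, ∑ j, (hρ.1.eigenvalues i * Real.log (hρ.1.eigenvalues i) -
        hρ.1.eigenvalues i * Real.log (hσ.1.eigenvalues j) -
        (hρ.1.eigenvalues i - hσ.1.eigenvalues j)) *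
          Complex.normSq (eigenOverlap hρ.1 hσ.1 j i) := by
    simp only [divergenceMax, Finset.mul_sum, ← mul_assoc]
    have hi (i j : Fin k) := (intervalIntegrable_scalarDivergence (hρ.eigenvalues_pos i)
      (hσ.eigenvalues_pos j)).mul_const (Complex.normSq (eigenOverlap hρ.1 hσ.1 j i))
    rw [intervalIntegral.integral_finsetSum]
    · refine Finset.sum_congr rfl fun i _ => ?_
      rw [intervalIntegral.integral_finsetSum fun j _ => hi i j]
      refine Finset.sum_congr rfl fun j _ => ?_
      rw [intervalIntegral.integral_mul_const,
        integral_scalarDivergence (hρ.eigenvalues_pos i) (hσ.eigenvalues_pos j)]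
    · intro i _
      have := IntervalIntegrable.sum Finset.univ fun j _ => hi i j
      simpa only [Finset.sum_fn] using this
  rw [quantumRelEntropy, hlog, trace_sub, Complex.sub_re, h₁, h₂, h₃, h₄, hint]
  simp only [← Finset.sum_sub_distrib, ← Finset.sum_add_distrib]
  refine Finset.sum_congr rfl fun i _ => Finset.sum_congr rfl fun j _ => ?_
  ring

lemma Matrix.PosDef.convexComb {n : Type*} [Fintype n] {A B : Matrix n n ℂ} (hA : A.PosDef)
    (hB : B.PosDef) {c : ℝ} (hc0 : 0 ≤ c) (hc1 : c ≤ 1) : (c • A + (1 - c) • B).PosDef := by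
  rcases hc0.eq_or_lt with rfl | hc0
  · simpa using hB
  · exact (hA.smul hc0).add_posSemidef (hB.posSemidef.smul (sub_nonneg.2 hc1))

/-- Joint convexity of the quantum relative entropy on pairs of positive definite density
matrices (Lieb–Ruskai). -/
theorem quantumRelEntropy_jointly_convex {k : ℕ}
    (ρ₁ ρ₂ σ₁ σ₂ : Matrix (Fin k) (Fin k) ℂ)
    (hρ₁ : ρ₁.PosDef) (hρ₂ : ρ₂.PosDef) (hσ₁ : σ₁.PosDef) (hσ₂ : σ₂.PosDef)
    (htρ₁ : ρ₁.trace = 1) (htρ₂ : ρ₂.trace = 1) (htσ₁ : σ₁.trace = 1) (htσ₂ : σ₂.trace = 1)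
    (c : ℝ) (hc0 : 0 ≤ c) (hc1 : c ≤ 1) :
    quantumRelEntropy (c • ρ₁ + (1 - c) • ρ₂) (c • σ₁ + (1 - c) • σ₂)
      ≤ c * quantumRelEntropy ρ₁ σ₁ + (1 - c) * quantumRelEntropy ρ₂ σ₂ := by
  have hρ := hρ₁.convexComb hρ₂ hc0 hc1
  have hσ := hσ₁.convexComb hσ₂ hc0 hc1
  have hi₁ := (intervalIntegrable_divergenceMax hρ₁ hσ₁).const_mul c
  have hi₂ := (intervalIntegrable_divergenceMax hρ₂ hσ₂).const_mul (1 - c)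
  have hmono : ∫ t in (0 : ℝ)..1, (1 - t) * divergenceMax hρ.1 hσ.1 t ≤
      ∫ t in (0 : ℝ)..1, (c * ((1 - t) * divergenceMax hρ₁.1 hσ₁.1 t) +
        (1 - c) * ((1 - t) * divergenceMax hρ₂.1 hσ₂.1 t)) := by
    refine intervalIntegral.integral_mono_on zero_le_one
      (intervalIntegrable_divergenceMax hρ hσ) (hi₁.add hi₂) fun t ht => ?_
    have := mul_le_mul_of_nonneg_left
      (divergenceMax_convexComb_le hρ₁ hρ₂ hσ₁ hσ₂ hc0 hc1 hρ hσ ht) (sub_nonneg.2 ht.2)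
    linarith
  rw [intervalIntegral.integral_add hi₁ hi₂, intervalIntegral.integral_const_mul,
    intervalIntegral.integral_const_mul] at hmono
  rw [quantumRelEntropy_eq_integral hρ hσ, quantumRelEntropy_eq_integral hρ₁ hσ₁,
    quantumRelEntropy_eq_integral hρ₂ hσ₂]
  simp only [trace_add, trace_smul, htρ₁, htρ₂, htσ₁, htσ₂, sub_self]
  linarith
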